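/- Let G be a 2-connected finite simple graph and S ⊆ V(G). If α_G(S) ≤ κ_G(S), then G has a cycle covering S. -/

import Mathlib

open SimpleGraph Set

variable {V : Type*}

/-- The independence number of `S` in `G`: the maximum cardinality of a subset of `S`
that is independent in `G`. -/
noncomputable def indepNumOn (G : SimpleGraph V) (S : Set V) : ℕ :=
  sSup {n | ∃ I : Set V, I ⊆ S ∧ I.Pairwise (fun a b => ¬ G.Adj a b) ∧ I.ncard = n}

/-- `I` is a maximum independent subset of `S` in `G`. -/
def MaxIndepOn (G : SimpleGraph V) (S : Set V) (I : Set V) : Prop :=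
  I ⊆ S ∧ I.Pairwise (fun a b => ¬ G.Adj a b) ∧ I.ncard = indepNumOn G S

/-- Two `x`–`y` walks are internally disjoint if they share only `x` and `y`. -/
def InternallyDisjoint (G : SimpleGraph V) {x y : V} (p q : G.Walk x y) : Prop :=
  ∀ v, v ∈ p.support → v ∈ q.support → v = x ∨ v = y

/-- Local connectivity `κ_G(x,y)`: maximum number of pairwise internally disjoint
`x`–`y` paths in `G`. -/
noncomputable def localConn (G : SimpleGraph V) (x y : V) : ℕ :=
  sSup {n | ∃ P : Set (G.Path x y),
    P.Pairwise (fun p q => InternallyDisjoint G p.1 q.1) ∧ P.ncard = n}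

/-- `κ_G(S)`: the minimum of local connectivities over distinct pairs in `S`,
`+∞` if `S` has at most one element. -/
noncomputable def setConn (G : SimpleGraph V) (S : Set V) : ℕ∞ :=
  ⨅ x ∈ S, ⨅ y ∈ S, ⨅ _ : x ≠ y, (localConn G x y : ℕ∞)

/-- Vertex connectivity `κ(G)`: the maximum `k` such that `G` has more than `k`
vertices and removing fewer than `k` vertices always leaves a connected graph. -/
noncomputable def vertexConn (G : SimpleGraph V) [Fintype V] : ℕ :=
  sSup {k | k < Fintype.card V ∧ ∀ X : Finset V, X.card < k →
    (G.induce ((↑X : Set V)ᶜ)).Connected}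

/-- The set of leaves (vertices of degree one) of a subgraph. -/
def subLeaves {G : SimpleGraph V} (T : G.Subgraph) : Set V :=
  {v | v ∈ T.verts ∧ (T.neighborSet v).ncard = 1}

/-- The set of branch vertices (vertices of degree at least three) of a subgraph. -/
def subBranches {G : SimpleGraph V} (T : G.Subgraph) : Set V :=
  {v | v ∈ T.verts ∧ 3 ≤ (T.neighborSet v).ncard}

theorem List.exists_first {α : Type*} (p : α → Prop) {l : List α} (h : ∃ v ∈ l, p v) :
    ∃ a v b, l = a ++ v :: b ∧ p v ∧ ∀ u ∈ a, ¬ p u := by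
  induction l with
  | nil => simp at h
  | cons c l ih =>
    by_cases hc : p c
    · exact ⟨[], c, l, rfl, hc, by simp⟩
    · obtain ⟨a, v, b, rfl, hv, ha⟩ := ih (by grind)
      exact ⟨c :: a, v, b, rfl, hv, by grind⟩

theorem List.exists_last {α : Type*} (p : α → Prop) {l : List α} (h : ∃ v ∈ l, p v) :
    ∃ a v b, l = a ++ v :: b ∧ p v ∧ ∀ u ∈ b, ¬ p u := by
  obtain ⟨a, v, b, hl, hv, ha⟩ := List.exists_first p (l := l.reverse) (by simpa using h)
  refine ⟨b.reverse, v, a.reverse, ?_, hv, by simpa using ha⟩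
  rw [← List.reverse_reverse l, hl]; simp

/-- `l` is an `E`-chain starting in `A` and ending in `B`. -/
def IsLink (E : Finset (V × V)) (A B : Set V) (l : List V) : Prop :=
  l.IsChain (fun a b => (a, b) ∈ E) ∧ (∃ a ∈ A, a ∈ l.head?) ∧ ∃ b ∈ B, b ∈ l.getLast?

/-- `X` meets every `E`-chain from `A` to `B`. -/
def Separates (E : Finset (V × V)) (A B : Set V) (X : Finset V) : Prop :=
  ∀ l, IsLink E A B l → ∃ v ∈ l, v ∈ X

theorem Finset.forall_exists_eq_of_card_eq {α : Type*} {k : ℕ} {X : Finset α} (hX : X.card = k)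
    {e : Fin k → α} (he : ∀ i, e i ∈ X) (hinj : Function.Injective e) : ∀ v ∈ X, ∃ i, e i = v := by
  classical
  have himg : Finset.univ.image e = X := by
    apply Finset.eq_of_subset_of_card_le
    · intro v; simp only [Finset.mem_image]; rintro ⟨i, -, rfl⟩; exact he i
    · rw [Finset.card_image_of_injective _ hinj]; simp [hX]
  intro v hv
  rw [← himg] at hv; simpa using hv

theorem List.IsChain.erase_pair {E : Finset (V × V)} [DecidableEq V] {x y : V} {l : List V}
    (hl : l.IsChain (fun a b => (a, b) ∈ insert (x, y) E))
    (h : ∀ s t, l ≠ s ++ x :: y :: t) : l.IsChain (fun a b => (a, b) ∈ E) := by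
  rw [List.isChain_iff_forall_rel_of_append_cons_cons] at hl ⊢
  intro a b s t hst
  have := hl hst
  simp only [Finset.mem_insert, Prod.mk.injEq] at this
  rcases this with ⟨rfl, rfl⟩ | h'
  · exact (h _ _ hst).elim
  · exact h'

/-- Disjoint paths ending in `X`, as many as `X` has elements, can be indexed by their ends. -/
theorem exists_index_last {k : ℕ} {E : Finset (V × V)} {A : Set V} {X : Finset V}
    (hX : X.card = k) {P : Fin k → List V} (hP : ∀ i, IsLink E A X (P i) ∧ (P i).Nodup)
    (hd : ∀ i j, i ≠ j → (P i).Disjoint (P j)) :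
    ∃ p : V → List V, (∀ v ∈ X, IsLink E A {v} (p v ++ [v]) ∧ (p v ++ [v]).Nodup) ∧
      ∀ v ∈ X, ∀ w ∈ X, v ≠ w → (p v ++ [v]).Disjoint (p w ++ [w]) := by
  choose e he hel using fun i => (hP i).1.2.2
  have hmem : ∀ i, e i ∈ P i := fun i => List.mem_of_getLast? (hel i)
  have hinj : Function.Injective e := fun i j hij => by
    by_contra hne
    exact hd i j hne (hmem i) (hij ▸ hmem j)
  have hs := Finset.forall_exists_eq_of_card_eq hX he hinj
  have : ∀ v, ∃ p, v ∈ X → ∃ i, e i = v ∧ P i = p ++ [v] := by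
    intro v
    by_cases hv : v ∈ X
    · obtain ⟨i, rfl⟩ := hs v hv
      obtain ⟨p, hp⟩ := List.getLast?_eq_some_iff.1 (hel i)
      exact ⟨p, fun _ => ⟨i, rfl, hp⟩⟩
    · exact ⟨[], fun h => (hv h).elim⟩
  choose p hp using this
  refine ⟨p, fun v hv => ?_, fun v hv w hw hvw => ?_⟩
  · obtain ⟨i, -, hi⟩ := hp v hv
    obtain ⟨⟨h1, h2, -⟩, h3⟩ := hP i
    rw [hi] at h1 h2 h3
    exact ⟨⟨h1, h2, v, rfl, by simp⟩, h3⟩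
  · obtain ⟨i, hi, hi'⟩ := hp v hv
    obtain ⟨j, hj, hj'⟩ := hp w hw
    rw [← hi', ← hj']
    exact hd i j (by rintro rfl; exact hvw (hi.symm.trans hj))

/-- Disjoint paths starting in `X`, as many as `X` has elements, can be indexed by their starts. -/
theorem exists_index_head {k : ℕ} {E : Finset (V × V)} {B : Set V} {X : Finset V}
    (hX : X.card = k) {P : Fin k → List V} (hP : ∀ i, IsLink E X B (P i) ∧ (P i).Nodup)
    (hd : ∀ i j, i ≠ j → (P i).Disjoint (P j)) :
    ∃ p : V → List V, (∀ v ∈ X, IsLink E {v} B (v :: p v) ∧ (v :: p v).Nodup) ∧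
      ∀ v ∈ X, ∀ w ∈ X, v ≠ w → (v :: p v).Disjoint (w :: p w) := by
  choose e he hel using fun i => (hP i).1.2.1
  have hmem : ∀ i, e i ∈ P i := fun i => List.mem_of_mem_head? (hel i)
  have hinj : Function.Injective e := fun i j hij => by
    by_contra hne
    exact hd i j hne (hmem i) (hij ▸ hmem j)
  have hs := Finset.forall_exists_eq_of_card_eq hX he hinj
  have : ∀ v, ∃ p, v ∈ X → ∃ i, e i = v ∧ P i = v :: p := by
    intro v
    by_cases hv : v ∈ X
    · obtain ⟨i, rfl⟩ := hs v hv
      obtain ⟨p, hp⟩ := List.head?_eq_some_iff.1 (hel i)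
      exact ⟨p, fun _ => ⟨i, rfl, hp⟩⟩
    · exact ⟨[], fun h => (hv h).elim⟩
  choose p hp using this
  refine ⟨p, fun v hv => ?_, fun v hv w hw hvw => ?_⟩
  · obtain ⟨i, -, hi⟩ := hp v hv
    obtain ⟨⟨h1, -, h2⟩, h3⟩ := hP i
    rw [hi] at h1 h2 h3
    exact ⟨⟨h1, ⟨v, rfl, by simp⟩, h2⟩, h3⟩
  · obtain ⟨i, hi, hi'⟩ := hp v hv
    obtain ⟨j, hj, hj'⟩ := hp w hw
    rw [← hi', ← hj']
    exact hd i j (by rintro rfl; exact hvw (hi.symm.trans hj))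

theorem IsLink.mono {E F : Finset (V × V)} (h : E ⊆ F) {A B : Set V} {l : List V}
    (hl : IsLink E A B l) : IsLink F A B l :=
  ⟨hl.1.imp fun _ _ hab => h hab, hl.2⟩

/-- The initial part of a link up to its first vertex in `X` only uses edges of `E`. -/
theorem Separates.of_left {E : Finset (V × V)} [DecidableEq V] {A B : Set V} {X T : Finset V}
    {x y : V} (hx : x ∈ X) (hX : Separates (insert (x, y) E) A B X) (hT : Separates E A X T) :
    Separates (insert (x, y) E) A B T := by
  rintro l hl
  obtain ⟨a, v, b, rfl, hv, ha⟩ := List.exists_first (· ∈ X) (hX l hl)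
  obtain ⟨hc, ⟨a', ha', hh⟩, -⟩ := hl
  have hc' : (a ++ [v]).IsChain (fun a b => (a, b) ∈ insert (x, y) E) :=
    List.IsChain.left_of_append (l₂ := b) (by simpa using hc)
  suffices hl : IsLink E A X (a ++ [v]) by
    obtain ⟨t, ht, htT⟩ := hT _ hl
    exact ⟨t, by grind, htT⟩
  refine ⟨hc'.erase_pair ?_, ⟨a', ha', ?_⟩, v, hv, by simp⟩
  · intro s t hst
    refine ha x ?_ hx
    have : a = s ++ x :: (y :: t).dropLast := by
      have := congrArg List.dropLast hst
      simpa using this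
    simp [this]
  · cases a <;> simpa using hh

/-- The final part of a link from its last vertex in `Y` only uses edges of `E`. -/
theorem Separates.of_right {E : Finset (V × V)} [DecidableEq V] {A B : Set V} {Y T : Finset V}
    {x y : V} (hy : y ∈ Y) (hY : Separates (insert (x, y) E) A B Y) (hT : Separates E Y B T) :
    Separates (insert (x, y) E) A B T := by
  rintro l hl
  obtain ⟨a, v, b, rfl, hv, hb⟩ := List.exists_last (· ∈ Y) (hY l hl)
  obtain ⟨hc, -, b', hb', hh⟩ := hl
  suffices hl : IsLink E Y B (v :: b) by
    obtain ⟨t, ht, htT⟩ := hT _ hl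
    exact ⟨t, by grind, htT⟩
  refine ⟨hc.right_of_append.erase_pair ?_, ⟨v, hv, by simp⟩, b', hb', ?_⟩
  · intro s t hst
    refine hb y ?_ hy
    rcases s with _ | ⟨c, s⟩
    · simp at hst; simp [hst]
    · simp at hst; simp [hst]
  · simpa using hh

/-- Menger's theorem for sets of vertices of a finite digraph. -/
theorem exists_disjoint_links [Finite V] (E : Finset (V × V)) : ∀ (A B : Set V) (k : ℕ),
    (∀ X, Separates E A B X → k ≤ X.card) →
    ∃ P : Fin k → List V, (∀ i, IsLink E A B (P i) ∧ (P i).Nodup) ∧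
      ∀ i j, i ≠ j → (P i).Disjoint (P j) := by
  classical
  have := Fintype.ofFinite V
  induction E using Finset.induction_on with
  | empty =>
    intro A B k h
    have := h (A ∩ B).toFinset (by
      rintro (_ | ⟨a, _ | ⟨b, l⟩⟩) ⟨hc, ⟨a', ha, ha'⟩, b', hb, hb'⟩
      · simp at ha'
      · simp at ha' hb'; subst ha' hb'; exact ⟨a, by simp, by simp [ha, hb]⟩
      · simp at hc)
    obtain ⟨T, hT, hTk⟩ := Finset.exists_subset_card_eq this
    let e := T.equivFinOfCardEq hTk
    refine ⟨fun i => [(e.symm i : V)], fun i => ⟨⟨by simp, ?_, ?_⟩, by simp⟩, fun i j hij => ?_⟩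
    · exact ⟨_, (by simpa using hT (e.symm i).2 : _ ∧ _).1, by simp⟩
    · exact ⟨_, (by simpa using hT (e.symm i).2 : _ ∧ _).2, by simp⟩
    · simpa [Subtype.ext_iff] using fun h => hij (e.symm.injective (Subtype.ext h)).symm
  | insert e E _ ih =>
    obtain ⟨x, y⟩ := e
    intro A B k h
    by_cases hE : ∀ X, Separates E A B X → k ≤ X.card
    · obtain ⟨P, hP, hd⟩ := ih A B k hE
      exact ⟨P, fun i => ⟨(hP i).1.mono (Finset.subset_insert _ _), (hP i).2⟩, hd⟩
    push Not at hE
    obtain ⟨S, hS, hSk⟩ := hE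
    have hXsep : Separates (insert (x, y) E) A B (insert x S) := by
      intro l hl
      by_cases hx : x ∈ l
      · exact ⟨x, hx, by simp⟩
      · obtain ⟨v, hv, hvS⟩ := hS l ⟨hl.1.erase_pair (by rintro s t rfl; simp at hx), hl.2⟩
        exact ⟨v, hv, by simp [hvS]⟩
    have hYsep : Separates (insert (x, y) E) A B (insert y S) := by
      intro l hl
      by_cases hy : y ∈ l
      · exact ⟨y, hy, by simp⟩
      · obtain ⟨v, hv, hvS⟩ := hS l ⟨hl.1.erase_pair (by rintro s t rfl; simp at hy), hl.2⟩
        exact ⟨v, hv, by simp [hvS]⟩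
    have hXk := h _ hXsep
    have hYk := h _ hYsep
    have hxS : x ∉ S := fun hx => by rw [Finset.insert_eq_of_mem hx] at hXk; omega
    have hyS : y ∉ S := fun hy => by rw [Finset.insert_eq_of_mem hy] at hYk; omega
    have hXk' : (insert x S).card = k := by rw [Finset.card_insert_of_notMem hxS] at *; omega
    have hYk' : (insert y S).card = k := by rw [Finset.card_insert_of_notMem hyS] at *; omega
    obtain ⟨P, hP, hPd⟩ := ih A (insert x S : Finset V) k
      fun T hT => h T (hXsep.of_left (by simp) hT)
    obtain ⟨Q, hQ, hQd⟩ := ih (insert y S : Finset V) B k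
      fun T hT => h T (hYsep.of_right (by simp) hT)
    obtain ⟨p, hp, hpd⟩ := exists_index_last hXk' hP hPd
    obtain ⟨q, hq, hqd⟩ := exists_index_head hYk' hQ hQd
    clear hP hPd hQ hQd P Q
    have hpX : ∀ v ∈ insert x S, ∀ u ∈ p v, u ∉ insert x S := by
      intro v hv u hu hu'
      rcases eq_or_ne v u with rfl | hne
      · have := (hp v hv).2
        simp [List.nodup_append] at this
        exact this.2 v hu rfl
      · exact hpd v hv u hu' hne (a := u) (by simp [hu]) (by simp)
    have hqY : ∀ v ∈ insert y S, ∀ u ∈ q v, u ∉ insert y S := by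
      intro v hv u hu hu'
      rcases eq_or_ne v u with rfl | hne
      · have := (hq v hv).2
        simp [hu] at this
      · exact hqd v hv u hu' hne (a := u) (by simp [hu]) (by simp)
    have hpq : ∀ v ∈ insert x S, ∀ w ∈ insert y S, ∀ u, u ∈ p v ++ [v] → u ∈ w :: q w →
        u = v ∧ u = w ∧ u ∈ S := by
      intro v hv w hw u hu hu'
      suffices huS : u ∈ S by
        refine ⟨?_, ?_, huS⟩
        · have := hpX v hv u
          grind
        · have := hqY w hw u
          grind
      by_contra huS
      obtain ⟨a, b, hab⟩ := List.append_of_mem hu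
      obtain ⟨c, d, hcd⟩ := List.append_of_mem hu'
      obtain ⟨⟨hpc, hph, -⟩, hpn⟩ := hp v hv
      obtain ⟨⟨hqc, -, hqh⟩, hqn⟩ := hq w hw
      rw [hab] at hpc hph hpn
      rw [hcd] at hqc hqh hqn
      have hl : IsLink E A B (a ++ u :: d) := by
        refine ⟨?_, ?_, ?_⟩
        · rw [List.isChain_split] at hpc hqc ⊢
          exact ⟨hpc.1, hqc.2⟩
        · cases a <;> simpa using hph
        · simpa using hqh
      obtain ⟨s, hs, hsS⟩ := hS _ hl
      rcases (by simpa using hs : s ∈ a ∨ s = u ∨ s ∈ d) with h1 | rfl | h1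
      · have : s ∈ p v ++ [v] := by rw [hab]; simp [h1]
        have hsv : s = v := by have := hpX v hv s; grind
        rcases List.eq_nil_or_concat' b with rfl | ⟨b, z, rfl⟩
        · have := (List.append_inj' hab rfl).2
          grind
        · rw [← List.cons_append, ← List.append_assoc] at hab
          have := (List.append_inj' hab rfl).2
          grind
      · exact huS hsS
      · have : s ∈ w :: q w := by rw [hcd]; simp [h1]
        have hsw : s = w := by have := hqY w hw s; grind
        cases c <;> grind
    let R : V → List V := fun v => if v ∈ S then p v ++ v :: q v else p x ++ x :: y :: q y
    have hR : ∀ v ∈ insert x S, IsLink (insert (x, y) E) A B (R v) ∧ (R v).Nodup := by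
      intro v hv
      by_cases hvS : v ∈ S
      · have h1 := hp v hv
        have h2 := hq v (by simp [hvS])
        have h3 := hpq v hv v (by simp [hvS])
        simp only [R, hvS, if_true]
        refine ⟨IsLink.mono (Finset.subset_insert _ _) ⟨?_, ?_, ?_⟩, ?_⟩
        · rw [List.isChain_split]; exact ⟨h1.1.1, h2.1.1⟩
        · have := h1.1.2.1; cases hpv : p v <;> simpa [hpv] using this
        · simpa using h2.1.2.2
        · have := h1.2; have := h2.2
          grind
      · obtain rfl : v = x := by simpa [hvS] using hv
        have h1 := hp v hv
        have h2 := hq y (by simp)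
        have h3 := hpq v hv y (by simp)
        simp only [R, hvS, if_false]
        refine ⟨⟨?_, ?_, ?_⟩, ?_⟩
        · rw [List.isChain_append_cons_cons]
          exact ⟨h1.1.1.imp fun _ _ h => Finset.mem_insert_of_mem h, by simp,
            h2.1.1.imp fun _ _ h => Finset.mem_insert_of_mem h⟩
        · have := h1.1.2.1; cases hpv : p v <;> simpa [hpv] using this
        · simpa using h2.1.2.2
        · have := h1.2; have := h2.2
          grind
    have hRm : ∀ v ∈ insert x S, ∃ w ∈ insert y S, (v ∈ S ∧ w = v ∨ v = x ∧ w = y) ∧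
        ∀ u ∈ R v, u ∈ p v ++ [v] ∨ u ∈ w :: q w := by
      intro v hv
      by_cases hvS : v ∈ S
      · refine ⟨v, by simp [hvS], by simp [hvS], ?_⟩
        simp only [R, hvS, if_true]; grind
      · obtain rfl : v = x := by simpa [hvS] using hv
        refine ⟨y, by simp, by simp, ?_⟩
        simp only [R, hvS, if_false]; grind
    have hRd : ∀ v ∈ insert x S, ∀ w ∈ insert x S, v ≠ w → (R v).Disjoint (R w) := by
      intro v hv w hw hvw u hu hu'
      obtain ⟨v', hv', hvv, hvm⟩ := hRm v hv
      obtain ⟨w', hw', hww, hwm⟩ := hRm w hw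
      have h1 := hpd v hv w hw hvw (a := u)
      have h2 := hqd v' hv' w' hw' (by grind) (a := u)
      have h3 := hpq v hv w' hw' u
      have h4 := hpq w hw v' hv' u
      have h5 := hvm u hu
      have h6 := hwm u hu'
      clear hvm hwm hpq hqd hpd hRm hR hpX hqY hp hq ih h
      grind
    let e := (insert x S).equivFinOfCardEq hXk'
    exact ⟨fun i => R (e.symm i), fun i => hR _ (e.symm i).2, fun i j hij =>
      hRd _ (e.symm i).2 _ (e.symm j).2 fun h => hij (e.symm.injective (Subtype.ext h))⟩

theorem exists_separator_links [Finite V] (E : Finset (V × V)) (A B : Set V) :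
    ∃ X, Separates E A B X ∧ ∃ P : Fin X.card → List V,
      (∀ i, IsLink E A B (P i) ∧ (P i).Nodup) ∧ ∀ i j, i ≠ j → (P i).Disjoint (P j) := by
  classical
  have := Fintype.ofFinite V
  have huniv : Separates E A B Finset.univ := by
    rintro l ⟨-, ⟨a, -, ha⟩, -⟩
    exact ⟨a, List.mem_of_mem_head? ha, by simp⟩
  obtain ⟨X, hX, hmin⟩ := Finset.exists_min_image
    (Finset.univ.filter fun X => Separates E A B X) Finset.card ⟨Finset.univ, by simpa using huniv⟩
  exact ⟨X, by simpa using hX, exists_disjoint_links E A B _ fun Y hY => hmin Y (by simpa using hY)⟩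

/-- The fan lemma: a set `X` separating `x` from `C` together with a fan from `x` to `C`
consisting of `X.card` paths. -/
theorem exists_fan [Finite V] (G : SimpleGraph V) (x : V) (C : Set V) :
    ∃ X : Finset V,
      (∀ l : List V, (x :: l).IsChain G.Adj → (x :: l).Nodup → (∃ c ∈ C, c ∈ l.getLast?) →
        ∃ v ∈ l, v ∈ X) ∧
      ∃ (e : Fin X.card → V) (p : Fin X.card → List V),
        (∀ i, (x :: (p i ++ [e i])).IsChain G.Adj ∧ (x :: (p i ++ [e i])).Nodup ∧ e i ∈ C ∧
          ∀ u ∈ p i, u ∉ C) ∧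
        ∀ i j, i ≠ j → (p i ++ [e i]).Disjoint (p j ++ [e j]) := by
  classical
  have := Fintype.ofFinite V
  let E : Finset (V × V) := Finset.univ.filter fun a => G.Adj a.1 a.2 ∧ a.1 ≠ x ∧ a.2 ≠ x
  obtain ⟨X, hX, P, hP, hd⟩ := exists_separator_links E {a | G.Adj x a} C
  refine ⟨X, ?_, ?_⟩
  · intro l hc hn hl
    rcases l with _ | ⟨a, l⟩
    · simp at hl
    · rw [List.isChain_cons_cons] at hc
      refine hX _ ⟨hc.2.imp_of_mem_imp ?_, ⟨a, hc.1, by simp⟩, hl⟩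
      intro b c hb hc hbc
      simp only [E, Finset.mem_filter, Finset.mem_univ, true_and]
      grind
  · have hf : ∀ i, ∃ p e b, P i = p ++ e :: b ∧ e ∈ C ∧ ∀ u ∈ p, u ∉ C := fun i => by
      refine List.exists_first (· ∈ C) ?_
      obtain ⟨b, hb, hb'⟩ := (hP i).1.2.2
      exact ⟨b, List.mem_of_getLast? hb', hb⟩
    choose p e b hPp he hp using hf
    refine ⟨e, p, fun i => ⟨?_, ?_, he i, hp i⟩, fun i j hij => ?_⟩
    · have hi := (hP i).1
      rw [hPp] at hi
      obtain ⟨hc, ⟨a, ha, ha'⟩, -⟩ := hi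
      rw [List.isChain_split] at hc
      rw [List.isChain_cons]
      refine ⟨?_, hc.1.imp fun c d h => ?_⟩
      · have : (p i ++ [e i]).head? = some a := by cases h : p i <;> simpa [h] using ha'
        rw [this]; rintro y ⟨⟩; exact ha
      · simp only [E, Finset.mem_filter] at h; exact h.2.1
    · have hi := (hP i).1
      have hn := (hP i).2
      rw [hPp] at hi hn
      refine List.nodup_cons.2 ⟨?_, by grind⟩
      obtain ⟨hc, ⟨a, ha, ha'⟩, -⟩ := hi
      have hx : ∀ u ∈ p i ++ e i :: b i, u ≠ x := by
        refine hc.induction (· ≠ x) _ ?_ ?_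
        · intro u v h _
          simp only [E, Finset.mem_filter] at h; exact h.2.2.2
        · intro h
          have : (p i ++ e i :: b i).head h = a := by
            rw [List.head?_eq_some_head h] at ha'; simpa using ha'
          rw [this]
          exact (G.ne_of_adj ha).symm
      intro hxm
      exact hx x (by grind) rfl
    · have := hd i j hij
      rw [hPp i, hPp j] at this
      intro u hu hu'
      exact this (a := u) (by grind) (by grind)

/-- A list of vertices that, read cyclically, is a cycle of `G`. -/
def IsCyclicList (G : SimpleGraph V) (l : List V) : Prop :=
  Cycle.Chain G.Adj (l : Cycle V) ∧ l.Nodup ∧ 3 ≤ l.length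

theorem IsCyclicList.rotated {G : SimpleGraph V} {l l' : List V} (hl : IsCyclicList G l)
    (h : l ~r l') : IsCyclicList G l' :=
  ⟨Cycle.coe_eq_coe.2 h ▸ hl.1, h.nodup_iff.1 hl.2.1, h.perm.length_eq ▸ hl.2.2⟩

theorem List.IsChain.reverse_adj {G : SimpleGraph V} {l : List V} (h : l.IsChain G.Adj) :
    l.reverse.IsChain G.Adj :=
  List.isChain_reverse.2 (h.imp fun _ _ h => h.symm)

/-- Three paths between `x`, `a` and `b`, disjoint apart from their ends, form a cycle. -/
theorem isCyclicList_of_paths {G : SimpleGraph V} {x a b : V} {p q m : List V}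
    (hp : (x :: (p ++ [a])).IsChain G.Adj) (hq : (x :: (q ++ [b])).IsChain G.Adj)
    (hm : (a :: (m ++ [b])).IsChain G.Adj) (hpn : (x :: p).Nodup) (hqn : (x :: q).Nodup)
    (hmn : (a :: (m ++ [b])).Nodup) (hpq : p.Disjoint q)
    (h : ∀ u ∈ a :: (m ++ [b]), u ≠ x ∧ u ∉ p ∧ u ∉ q) :
    IsCyclicList G (x :: (p ++ a :: (m ++ b :: q.reverse))) := by
  refine ⟨?_, ?_, by grind⟩
  · rw [Cycle.chain_coe_cons]
    have h1 : (x :: p ++ a :: (m ++ b :: (q.reverse ++ [x]))).IsChain G.Adj := by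
      rw [List.isChain_split]
      refine ⟨hp, ?_⟩
      rw [← List.cons_append, List.isChain_split]
      refine ⟨hm, ?_⟩
      simpa using hq.reverse_adj
    simpa using h1
  · have hrev : (x :: (p ++ q.reverse)).Nodup := by
      refine List.nodup_cons.2 ⟨by grind, ?_⟩
      exact List.nodup_append'.2 ⟨hpn.of_cons, List.nodup_reverse.2 hqn.of_cons, by simpa using hpq⟩
    have hall : (a :: (m ++ [b]) ++ x :: (p ++ q.reverse)).Nodup := by
      refine List.nodup_append'.2 ⟨hmn, hrev, fun u hu hu' => ?_⟩
      have := h u hu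
      simp only [List.mem_cons, List.mem_append, List.mem_reverse] at hu'
      tauto
    refine List.Perm.nodup ?_ hall
    rw [← Multiset.coe_eq_coe]
    simp only [← Multiset.cons_coe, ← Multiset.coe_add, List.cons_append, List.append_assoc,
      List.nil_append]
    simp only [← Multiset.singleton_add]
    abel

theorem IsCyclicList.exists_isCycle {G : SimpleGraph V} {l : List V} (hl : IsCyclicList G l) :
    ∃ (u : V) (c : G.Walk u u), c.IsCycle ∧ ∀ x ∈ l, x ∈ c.support := by
  obtain ⟨hc, hn, h3⟩ := hl
  rcases l with _ | ⟨a, l⟩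
  · simp at h3
  rw [Cycle.chain_coe_cons] at hc
  obtain ⟨p, hp⟩ : ∃ p : G.Walk a a, p.support = a :: (l ++ [a]) := by
    have h1 : ∀ (L : List V) (hne : L ≠ []) (_ : L.IsChain G.Adj), L.head hne = a →
        L.getLast hne = a → ∃ p : G.Walk a a, p.support = L := by
      rintro L hne hL h1 h2
      exact ⟨(Walk.ofSupport L hne hL).copy h1 h2, by simp⟩
    exact h1 _ (by simp) hc (by simp) (by simp)
  have hlen : p.length = l.length + 1 := by
    have := p.length_support
    rw [hp] at this; simpa using this.symm
  refine ⟨a, p, Walk.isCycle_iff_isPath_tail_and_le_length.2 ⟨?_, by simp at h3; omega⟩, ?_⟩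
  · have hnil : ¬ p.Nil := by rw [Walk.not_nil_iff_lt_length]; omega
    rw [Walk.isPath_def, Walk.support_tail_of_not_nil _ hnil, hp]
    grind
  · rw [hp]; grind

theorem exists_path_avoiding_of_card_lt_localConn {G : SimpleGraph V} {x y : V} {X : Finset V}
    (h : X.card < localConn G x y) :
    ∃ p : G.Path x y, ∀ v ∈ p.1.support, v ∈ X → v = x ∨ v = y := by
  obtain ⟨n, ⟨P, hP, rfl⟩, hn⟩ := exists_lt_of_lt_csSup
    (by exact ⟨0, ∅, by simp, by simp⟩) h
  by_contra hno
  push Not at hno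
  choose f hf hfX hfx hfy using hno
  refine hn.not_ge ?_
  rw [← Set.ncard_coe_finset]
  refine Set.ncard_le_ncard_of_injOn f (fun p _ => hfX p) ?_ X.finite_toSet
  intro p hp q hq hpq
  by_contra hne
  rcases hP hp hq hne (f p) (hf p) (hpq ▸ hf q) with h | h
  · exact hfx p h
  · exact hfy p h

theorem exists_path_avoiding_vertex {G : SimpleGraph V} {v a b : V}
    (h : (G.induce ({v}ᶜ : Set V)).Connected) (ha : a ≠ v) (hb : b ≠ v) :
    ∃ p : G.Walk a b, p.IsPath ∧ v ∉ p.support := by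
  have hmap : ∀ {a b : ({v}ᶜ : Set V)} (p : (G.induce ({v}ᶜ : Set V)).Walk a b), p.IsPath →
      ∃ q : G.Walk a b, q.IsPath ∧ v ∉ q.support := by
    intro a b p hp
    refine ⟨p.map (SimpleGraph.Embedding.induce (G := G) ({v}ᶜ : Set V)).toHom,
      hp.map Subtype.val_injective, fun hv => ?_⟩
    obtain ⟨u, -, hu⟩ := List.mem_map.1 ((Walk.support_map _ p) ▸ hv)
    exact u.2 hu
  obtain ⟨p, hp⟩ := h.exists_isPath ⟨a, by simpa using ha⟩ ⟨b, by simpa using hb⟩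
  exact hmap p hp

theorem List.IsRotated.cons_inj {α : Type*} {a : α} {l l' : List α} (h : (a :: l) ~r (a :: l'))
    (hn : (a :: l).Nodup) : l = l' := by
  obtain ⟨n, hle, h⟩ := List.isRotated_iff_mod.1 h
  rw [List.rotate_eq_drop_append_take hle] at h
  have ht := List.take_append_drop n (a :: l)
  rcases hp : (a :: l).take n with _ | ⟨b, p⟩ <;> rcases hr : (a :: l).drop n with _ | ⟨c, r⟩ <;>
    rw [hp, hr] at ht h <;> simp_all
  grind

theorem IsCyclicList.isChain {G : SimpleGraph V} {a : V} {l : List V}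
    (h : IsCyclicList G (a :: l)) : (a :: (l ++ [a])).IsChain G.Adj := by
  simpa [Cycle.chain_coe_cons] using h.1

theorem SimpleGraph.Walk.exists_support_eq {G : SimpleGraph V} {a b : V} (p : G.Walk a b)
    (h : a ≠ b) : ∃ m, p.support = a :: (m ++ [b]) := by
  cases p with
  | nil => exact (h rfl).elim
  | cons hadj q =>
    refine ⟨q.support.dropLast, ?_⟩
    have := List.dropLast_append_getLast q.support_ne_nil
    rw [Walk.getLast_support] at this
    rw [Walk.support_cons, this]

theorem exists_adj_ne [Fintype V] {G : SimpleGraph V} (hcard : 2 < Fintype.card V)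
    (h2conn : ∀ v : V, (G.induce ({v}ᶜ : Set V)).Connected) {x w : V} (h : x ≠ w) :
    ∃ y, G.Adj x y ∧ y ≠ w := by
  classical
  obtain ⟨u, hu⟩ : ∃ u, u ∉ ({x, w} : Finset V) := by
    by_contra! hno
    have h1 := Finset.card_le_card (fun v _ => hno v : Finset.univ ⊆ {x, w})
    have h2 := Finset.card_le_two (a := x) (b := w)
    rw [Finset.card_univ] at h1
    omega
  simp only [Finset.mem_insert, Finset.mem_singleton, not_or] at hu
  obtain ⟨p, -, hp⟩ := exists_path_avoiding_vertex (h2conn w) h hu.2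
  cases p with
  | nil => exact (hu.1 rfl).elim
  | cons hadj q => exact ⟨_, hadj, by rintro rfl; simp at hp⟩

theorem exists_isCyclicList [Fintype V] {G : SimpleGraph V} (hcard : 2 < Fintype.card V)
    (h2conn : ∀ v : V, (G.induce ({v}ᶜ : Set V)).Connected) : ∃ l, IsCyclicList G l := by
  have : Nontrivial V := Fintype.one_lt_card_iff_nontrivial.1 (by omega)
  obtain ⟨x, w, hxw⟩ := exists_pair_ne V
  obtain ⟨y, hy, -⟩ := exists_adj_ne hcard h2conn hxw
  obtain ⟨z, hz, hzy⟩ := exists_adj_ne hcard h2conn hy.ne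
  obtain ⟨p, hp, hxp⟩ := exists_path_avoiding_vertex (h2conn x) hy.ne' hz.ne'
  obtain ⟨m, hm⟩ := p.exists_support_eq hzy.symm
  refine ⟨_, isCyclicList_of_paths (x := x) (a := y) (b := z) (p := []) (q := []) (m := m)
    (by simpa using hy) (by simpa using hz) (hm ▸ p.isChain_adj_support) (by simp) (by simp)
    (hm ▸ hp.support_nodup) (by simp) ?_⟩
  rw [← hm]
  intro u hu
  exact ⟨by rintro rfl; exact hxp hu, by simp, by simp⟩

theorem two_le_card_of_separates {G : SimpleGraph V}
    (h2conn : ∀ v : V, (G.induce ({v}ᶜ : Set V)).Connected) {l : List V}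
    (hl : IsCyclicList G l) {x : V} (hx : x ∉ l) {X : Finset V}
    (hX : ∀ p : List V, (x :: p).IsChain G.Adj → (x :: p).Nodup →
      (∃ c ∈ {v | v ∈ l}, c ∈ p.getLast?) → ∃ v ∈ p, v ∈ X) : 2 ≤ X.card := by
  classical
  by_contra! hlt
  have : Nonempty V := ⟨x⟩
  obtain ⟨w, hw⟩ := Finset.card_le_one_iff_subset_singleton.1 (Nat.le_of_lt_succ hlt)
  obtain ⟨-, hn, h3⟩ := hl
  rcases l with _ | ⟨a, _ | ⟨b, l⟩⟩
  · simp at h3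
  · simp at h3
  obtain ⟨v, hvx, hv⟩ : ∃ v, x ≠ v ∧ ∀ u ∈ X, u = v ∨ u = x := by
    by_cases hwx : w = x
    · exact ⟨a, by grind, fun u hu => by have := hw hu; grind⟩
    · exact ⟨w, by grind, fun u hu => by have := hw hu; grind⟩
  obtain ⟨c, hc, hcv⟩ : ∃ c ∈ a :: b :: l, c ≠ v := by
    by_cases hav : a = v
    · exact ⟨b, by simp, by grind⟩
    · exact ⟨a, by simp, hav⟩
  obtain ⟨p, hp, hvp⟩ := exists_path_avoiding_vertex (h2conn v) hvx hcv
  obtain ⟨m, hm⟩ := p.exists_support_eq (by rintro rfl; exact hx hc)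
  have hpn := hp.support_nodup
  rw [hm] at hpn hvp
  obtain ⟨u, hu, huX⟩ := hX (m ++ [c]) (hm ▸ p.isChain_adj_support) hpn ⟨c, hc, by simp⟩
  rcases hv u huX with rfl | rfl <;> grind

theorem le_localConn_of_le_setConn {G : SimpleGraph V} {S : Set V} {n : ℕ}
    (h : (n : ℕ∞) ≤ setConn G S) {x y : V} (hx : x ∈ S) (hy : y ∈ S) (hxy : x ≠ y) :
    n ≤ localConn G x y := by
  have := h.trans (iInf₂_le_of_le x hx (iInf₂_le_of_le y hy (iInf_le_of_le hxy le_rfl)))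
  exact_mod_cast this

theorem ncard_le_indepNumOn [Finite V] {G : SimpleGraph V} {S I : Set V} (hS : I ⊆ S)
    (hI : I.Pairwise fun a b => ¬ G.Adj a b) : I.ncard ≤ indepNumOn G S := by
  refine le_csSup ⟨Nat.card V, ?_⟩ ⟨I, hS, hI, rfl⟩
  rintro _ ⟨J, -, -, rfl⟩
  exact Set.ncard_le_card J

/-- The structure of a fan from `x` to a cycle that cannot be rerouted through `x`. -/
theorem exists_rotated_of_fan {G : SimpleGraph V} {S : Set V} {l : List V}
    (hl : IsCyclicList G l) {k : ℕ} (hk : 2 ≤ k) {e : Fin k → V} (he : ∀ i, e i ∈ l)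
    (hinj : Function.Injective e)
    (hno : ∀ i j, i ≠ j → ∀ m, (e i :: (m ++ [e j])).IsChain G.Adj → (e i :: (m ++ [e j])).Nodup →
      (∀ u ∈ m, u ∈ l) → ∃ v ∈ S, v ∈ l ∧ v ∉ e i :: (m ++ [e j])) (i : Fin k) :
    ∃ m s q, l ~r (e i :: (m ++ s :: q)) ∧ s ∈ S ∧ s ∉ range e ∧ ∀ u ∈ m, u ∉ S ∧ u ∉ range e := by
  obtain ⟨j, hj⟩ : ∃ j, j ≠ i := by
    have : Nontrivial (Fin k) := Fin.nontrivial_iff_two_le.2 hk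
    exact exists_ne i
  obtain ⟨b, c, hbc⟩ := List.append_of_mem (he i)
  have hr : l ~r (e i :: (c ++ b)) := by
    rw [hbc]; exact List.isRotated_append
  have hjm : e j ∈ c ++ b := by
    have := hr.mem_iff.1 (he j)
    have := hinj.ne hj
    grind
  obtain ⟨m, s, q, hmq, hs, hm⟩ := List.exists_first (fun v => v ∈ S ∨ v ∈ range e)
    ⟨e j, hjm, Or.inr ⟨j, rfl⟩⟩
  rw [hmq] at hr
  have hse : s ∉ range e := by
    rintro ⟨h, rfl⟩
    have hcyc := hl.rotated hr
    have hn := hcyc.2.1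
    have hih : i ≠ h := by rintro rfl; simp at hn
    have hc : (e i :: (q.reverse ++ [e h])).IsChain G.Adj := by
      have h1 := hcyc.isChain
      rw [List.append_assoc, ← List.cons_append] at h1
      simpa using h1.right_of_append.reverse_adj
    have hqn : (e i :: (q.reverse ++ [e h])).Nodup := by
      simp only [List.nodup_cons, List.nodup_append, List.nodup_reverse, List.mem_append,
        List.mem_cons, List.mem_reverse] at hn ⊢
      grind
    obtain ⟨v, hvS, hvl, hv⟩ := hno i h hih q.reverse hc hqn
      (fun u hu => hr.mem_iff.2 (by grind))
    have := hr.mem_iff.1 hvl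
    have : v ∈ m := by grind
    exact hm v this (Or.inl hvS)
  exact ⟨m, s, q, hr, hs.resolve_right hse, hse, fun u hu => not_or.1 (hm u hu)⟩

theorem IsCyclicList.exists_rotated_pair {G : SimpleGraph V} {l : List V} (hl : IsCyclicList G l)
    {a b s t : V} {m n q r : List V} (hab : a ≠ b) (ha : l ~r (a :: (m ++ s :: q)))
    (hb : l ~r (b :: (n ++ t :: r))) (hbs : b ≠ s) (hat : a ≠ t) (hbm : b ∉ m) (han : a ∉ n) :
    ∃ u w, l ~r (a :: (m ++ s :: (u ++ b :: (n ++ t :: w)))) := by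
  have hbq : b ∈ q := by
    have := (ha.symm.trans hb).mem_iff (a := b)
    grind
  obtain ⟨u, w, rfl⟩ := List.append_of_mem hbq
  have h1 : (a :: (m ++ s :: (u ++ b :: w))) ~r (b :: (w ++ a :: (m ++ s :: u))) := by
    have := List.isRotated_append (l := a :: (m ++ s :: u)) (l' := b :: w)
    simpa using this
  have h2 := (h1.symm.trans (ha.symm.trans hb)).cons_inj (hl.rotated (ha.trans h1)).2.1
  refine ⟨u, ?_⟩
  suffices h : ∃ z, w = n ++ t :: z by
    obtain ⟨z, rfl⟩ := h
    exact ⟨z, ha⟩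
  rcases List.append_eq_append_iff.1 h2 with ⟨c, rfl, h3⟩ | ⟨c, rfl, h3⟩
  · rcases c with _ | ⟨d, c⟩
    · simp at h3; grind
    · simp at h3; grind
  · rcases c with _ | ⟨d, c⟩
    · simp at h3; grind
    · simp at h3; exact ⟨c, by simp [h3.1]⟩

/-- If a cycle cannot be rerouted through `x ∈ S` along a fan without losing a vertex of `S`,
then `S` has more independent vertices than the fan has paths. -/
theorem exists_successors_of_fan [Finite V] {G : SimpleGraph V} {S : Set V} {l : List V}
    (hl : IsCyclicList G l) {x : V} (hxS : x ∈ S) (hxl : x ∉ l)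
    (hno : ∀ l', IsCyclicList G l' → x ∈ l' → ∃ v ∈ S, v ∈ l ∧ v ∉ l')
    {k : ℕ} (hk : 2 ≤ k) {e : Fin k → V} {p : Fin k → List V}
    (hp : ∀ i, (x :: (p i ++ [e i])).IsChain G.Adj ∧ (x :: (p i ++ [e i])).Nodup ∧ e i ∈ l ∧
      ∀ u ∈ p i, u ∉ l)
    (hd : ∀ i j, i ≠ j → (p i ++ [e i]).Disjoint (p j ++ [e j])) :
    ∃ s : Fin k → V, Function.Injective s ∧ (∀ i, s i ∈ S ∧ s i ∈ l ∧ s i ∉ range e) ∧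
      k + 1 ≤ indepNumOn G S := by
  have hinj : Function.Injective e := fun i j hij => by
    by_contra hne
    exact hd i j hne (a := e i) (by simp) (by simp [hij])
  have hpn : ∀ i, (x :: p i).Nodup := fun i => by
    have := (hp i).2.1
    rw [← List.cons_append] at this
    exact this.of_append_left
  have hends : ∀ i j, i ≠ j → ∀ m, (e i :: (m ++ [e j])).IsChain G.Adj →
      (e i :: (m ++ [e j])).Nodup → (∀ u ∈ m, u ∈ l) →
      ∃ v ∈ S, v ∈ l ∧ v ∉ e i :: (m ++ [e j]) := by
    intro i j hij m hc hn hm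
    have hml : ∀ u ∈ e i :: (m ++ [e j]), u ∈ l := by
      have := (hp i).2.2.1
      have := (hp j).2.2.1
      grind
    obtain ⟨v, hvS, hvl, hv⟩ := hno _ (isCyclicList_of_paths (hp i).1 (hp j).1 hc (hpn i) (hpn j)
      hn (fun u hu hu' => hd i j hij (a := u) (by simp [hu]) (by simp [hu']))
      fun u hu => ⟨by rintro rfl; exact hxl (hml _ hu), fun h => (hp i).2.2.2 u h (hml u hu),
        fun h => (hp j).2.2.2 u h (hml u hu)⟩) (by simp)
    exact ⟨v, hvS, hvl, by grind⟩
  have hadj : ∀ i b m, G.Adj x b → (e i :: (m ++ [b])).IsChain G.Adj →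
      (e i :: (m ++ [b])).Nodup → (∀ u ∈ m, u ∈ l) → b ∈ l →
      ∃ v ∈ S, v ∈ l ∧ v ∉ e i :: (m ++ [b]) := by
    intro i b m hb hc hn hm hbl
    have hml : ∀ u ∈ e i :: (m ++ [b]), u ∈ l := by
      have := (hp i).2.2.1
      grind
    obtain ⟨v, hvS, hvl, hv⟩ := hno _ (isCyclicList_of_paths (q := []) (hp i).1 (by simpa using hb)
      hc (hpn i) (by simp) hn (by simp)
      fun u hu => ⟨by rintro rfl; exact hxl (hml _ hu), fun h => (hp i).2.2.2 u h (hml u hu),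
        by simp⟩) (by simp)
    exact ⟨v, hvS, hvl, by grind⟩
  choose m s q hr hsS hse hm using
    exists_rotated_of_fan hl hk (fun i => (hp i).2.2.1) hinj hends
  have hsl : ∀ i, s i ∈ l := fun i => (hr i).mem_iff.2 (by simp)
  have hpair : ∀ i j, i ≠ j →
      ∃ u w, l ~r (e i :: (m i ++ s i :: (u ++ e j :: (m j ++ s j :: w)))) := fun i j hij =>
    hl.exists_rotated_pair (hinj.ne hij) (hr i) (hr j) (fun h => hse i ⟨j, h⟩)
      (fun h => hse j ⟨i, h⟩) (fun h => (hm i _ h).2 ⟨j, rfl⟩) fun h => (hm j _ h).2 ⟨i, rfl⟩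
  have hsinj : Function.Injective s := fun i j hij => by
    by_contra hne
    obtain ⟨u, w, h⟩ := hpair i j hne
    have := (hl.rotated h).2.1
    rw [hij] at this
    simp [List.nodup_append] at this
  have hxs : ∀ i, ¬ G.Adj x (s i) := by
    intro i hxi
    have hcyc := hl.rotated (hr i)
    have hn := hcyc.2.1
    obtain ⟨v, hvS, hvl, hv⟩ := hadj i (s i) (q i).reverse hxi
      (by
        have h1 := hcyc.isChain
        rw [List.append_assoc, ← List.cons_append] at h1
        simpa using h1.right_of_append.reverse_adj)
      (by
        simp only [List.nodup_cons, List.nodup_append, List.nodup_reverse, List.mem_append,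
          List.mem_cons, List.mem_reverse] at hn ⊢
        grind)
      (fun u hu => (hr i).mem_iff.2 (by grind)) (hsl i)
    have := (hr i).mem_iff.1 hvl
    exact (hm i v (by grind)).1 hvS
  have hss : ∀ i j, i ≠ j → ¬ G.Adj (s i) (s j) := by
    intro i j hij hadj
    obtain ⟨u, w, h⟩ := hpair i j hij
    have hcyc := hl.rotated h
    have hn := hcyc.2.1
    obtain ⟨v, hvS, hvl, hv⟩ := hends i j hij (w.reverse ++ s j :: s i :: u)
      (by
        have h1 := hcyc.isChain
        have h2 : ((e i :: m i) ++ (s i :: (u ++ [e j])) ++ (m j ++ (s j :: (w ++ [e i])))).IsChain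
            G.Adj := by simpa using h1
        have h3 := h2.left_of_append.right_of_append
        have h4 := h2.right_of_append.right_of_append.reverse_adj
        have h5 : ((e i :: w.reverse) ++ s j :: (s i :: (u ++ [e j]))).IsChain G.Adj :=
          List.isChain_split.2 ⟨by simpa using h4, List.isChain_cons_cons.2 ⟨hadj.symm, h3⟩⟩
        simpa using h5)
      (by
        simp only [List.nodup_cons, List.nodup_append, List.nodup_reverse, List.mem_append,
          List.mem_cons, List.mem_reverse] at hn ⊢
        grind)
      (fun u hu => h.mem_iff.2 (by grind))
    have := h.mem_iff.1 hvl
    have : v ∈ m i ∨ v ∈ m j := by grind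
    exact this.elim (fun h => (hm i v h).1 hvS) fun h => (hm j v h).1 hvS
  refine ⟨s, hsinj, fun i => ⟨hsS i, hsl i, hse i⟩, ?_⟩
  have hcard : (insert x (range s)).ncard = k + 1 := by
    rw [Set.ncard_insert_of_notMem (by rintro ⟨i, rfl⟩; exact hxl (hsl i)), ← Set.image_univ,
      Set.ncard_image_of_injective _ hsinj]
    simp
  rw [← hcard]
  refine ncard_le_indepNumOn (Set.insert_subset hxS (by rintro _ ⟨i, rfl⟩; exact hsS i)) ?_
  rintro a (rfl | ⟨i, rfl⟩) b (rfl | ⟨j, rfl⟩) hab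
  · exact (hab rfl).elim
  · exact hxs j
  · exact fun h => hxs i h.symm
  · exact hss i j (by rintro rfl; exact hab rfl)

theorem IsCyclicList.exists_insert [Finite V] {G : SimpleGraph V}
    (h2conn : ∀ v : V, (G.induce ({v}ᶜ : Set V)).Connected) {S : Set V}
    (hακ : (indepNumOn G S : ℕ∞) ≤ setConn G S) {l : List V} (hl : IsCyclicList G l) {x : V}
    (hxS : x ∈ S) (hxl : x ∉ l) :
    ∃ l', IsCyclicList G l' ∧ x ∈ l' ∧ ∀ v ∈ S, v ∈ l → v ∈ l' := by
  by_contra! hno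
  obtain ⟨X, hX, e, p, hp, hd⟩ := exists_fan G x {v | v ∈ l}
  have h2 := two_le_card_of_separates h2conn hl hxl hX
  obtain ⟨s, hsinj, hs, hlt⟩ := exists_successors_of_fan hl hxS hxl hno h2 hp hd
  have hSX : ∀ y ∈ S, y ∈ l → y ∈ X := by
    intro y hyS hyl
    by_contra hyX
    have hxy : x ≠ y := by rintro rfl; exact hxl hyl
    obtain ⟨⟨r, hr⟩, hrX⟩ := exists_path_avoiding_of_card_lt_localConn (X := X)
      (lt_of_lt_of_le hlt (le_localConn_of_le_setConn hακ hxS hyS hxy))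
    obtain ⟨m, hm⟩ := r.exists_support_eq hxy
    have hn := hm ▸ hr.support_nodup
    obtain ⟨v, hv, hvX⟩ := hX (m ++ [y]) (hm ▸ r.isChain_adj_support) hn ⟨y, hyl, by simp⟩
    rcases hrX v (by rw [hm]; exact List.mem_cons_of_mem _ hv) hvX with rfl | rfl
    · exact (List.nodup_cons.1 hn).1 hv
    · exact hyX hvX
  let i : Fin X.card := ⟨0, by omega⟩
  obtain ⟨v, hv, hvX⟩ := hX _ (hp i).1 (hp i).2.1 ⟨e i, (hp i).2.2.1, by simp⟩
  obtain ⟨j, rfl⟩ := Finset.forall_exists_eq_of_card_eq rfl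
    (fun i => hSX (s i) (hs i).1 (hs i).2.1) hsinj v hvX
  rcases List.mem_append.1 hv with hv | hv
  · exact (hp i).2.2.2 _ hv (hs j).2.1
  · exact (hs j).2.2 ⟨i, (List.mem_singleton.1 hv).symm⟩

theorem exists_isCyclicList_covering [Fintype V] {G : SimpleGraph V}
    (hcard : 2 < Fintype.card V) (h2conn : ∀ v : V, (G.induce ({v}ᶜ : Set V)).Connected)
    {S : Set V} (hακ : (indepNumOn G S : ℕ∞) ≤ setConn G S) :
    ∃ l, IsCyclicList G l ∧ ∀ v ∈ S, v ∈ l := by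
  obtain ⟨l, hl⟩ := exists_isCyclicList hcard h2conn
  induction hn : (S \ {v | v ∈ l}).ncard using Nat.strong_induction_on generalizing l with
  | _ n ih =>
    by_cases hS : ∀ v ∈ S, v ∈ l
    · exact ⟨l, hl, hS⟩
    push Not at hS
    obtain ⟨x, hxS, hxl⟩ := hS
    obtain ⟨l', hl', hx, hsub⟩ := hl.exists_insert h2conn hακ hxS hxl
    refine ih _ ?_ l' hl' rfl
    rw [← hn]
    refine Set.ncard_lt_ncard ?_
    refine ⟨fun v hv => ⟨hv.1, fun h => hv.2 (hsub v hv.1 h)⟩, fun h => ?_⟩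
    exact (h ⟨hxS, hxl⟩).2 hx

/-- Ozeki–Yamashita: if `G` is 2-connected and `α_G(S) ≤ κ_G(S)`, then `G` has a
cycle covering `S`. -/
theorem stmt_12 [Fintype V] (G : SimpleGraph V)
    (hcard : 2 < Fintype.card V)
    (h2conn : ∀ v : V, (G.induce ({v}ᶜ : Set V)).Connected)
    (S : Set V) (hακ : (indepNumOn G S : ℕ∞) ≤ setConn G S) :
    ∃ (u : V) (c : G.Walk u u), c.IsCycle ∧ S ⊆ {x | x ∈ c.support} := by
  obtain ⟨l, hl, hS⟩ := exists_isCyclicList_covering hcard h2conn hακ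
  obtain ⟨u, c, hc, hlc⟩ := hl.exists_isCycle
  exact ⟨u, c, hc, fun x hx => hlc x (hS x hx)⟩
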